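/- Let G be a group with subgroups P and K such that G = PK, set K_P = P ∩ K, and let R be a commutative ring. If f : G → R lies in the Hecke algebra H_R(G//K), then its restriction f|_P to P lies in H_R(P//K_P), and the restriction map f ↦ f|_P is an R-algebra homomorphism H_R(G//K) → H_R(P//K_P); in particular (f ∗_K g)|_P = f|_P ∗_{K_P} g|_P for all f, g ∈ H_R(G//K). -/

import Mathlib

/-- `f : G → R` belongs to the Hecke algebra `H_R(G//H)`: it is `H`-bi-invariant and
its support is contained in a finite union of left cosets of `H`. -/
def IsHeckeFunction {G : Type*} [Group G] {R : Type*} [CommRing R]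
    (H : Subgroup G) (f : G → R) : Prop :=
  (∀ h ∈ H, ∀ h' ∈ H, ∀ g : G, f (h * g * h') = f g) ∧
  ∃ S : Finset G, Function.support f ⊆ ⋃ y ∈ S, (y * ·) '' (H : Set G)

/-- The convolution product on `H_R(G//H)`:
`(f ∗_H g)(x) = Σ_{yH ∈ G/H} f(y)·g(y⁻¹x)`, the sum over left cosets of `H` being
computed via a choice of representatives (for bi-invariant `f`, `g` each term depends
only on the coset `yH`). -/
noncomputable def heckeConv {G : Type*} [Group G] {R : Type*} [CommRing R]
    (H : Subgroup G) (f g : G → R) : G → R :=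
  fun x => ∑ᶠ c : G ⧸ H, f (Quotient.out c) * g ((Quotient.out c)⁻¹ * x)

theorem IsHeckeFunction.apply_mul_right {G : Type*} [Group G] {R : Type*} [CommRing R]
    {H : Subgroup G} {f : G → R} (hf : IsHeckeFunction H f) (g : G) {h : G} (hh : h ∈ H) :
    f (g * h) = f g := by
  simpa using hf.1 1 H.one_mem h hh g

theorem IsHeckeFunction.apply_mul_left {G : Type*} [Group G] {R : Type*} [CommRing R]
    {H : Subgroup G} {f : G → R} (hf : IsHeckeFunction H f) {h : G} (hh : h ∈ H) (g : G) :
    f (h * g) = f g := by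
  simpa using hf.1 h hh 1 H.one_mem g

/-- The summand of the convolution product depends only on the left coset. -/
theorem IsHeckeFunction.conv_term_eq {G : Type*} [Group G] {R : Type*} [CommRing R]
    {H : Subgroup G} {f g : G → R} (hf : IsHeckeFunction H f) (hg : IsHeckeFunction H g)
    {y z : G} (hyz : y⁻¹ * z ∈ H) (x : G) :
    f y * g (y⁻¹ * x) = f z * g (z⁻¹ * x) := by
  rw [← hf.apply_mul_right y hyz, ← hg.apply_mul_left (H.inv_mem hyz) (y⁻¹ * x)]
  congr 2 <;> group

/-- If every element of `G` lies in `PK`, every left coset of `K` meets `P`, so that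
restricting to `P` preserves Hecke functions. -/
theorem IsHeckeFunction.restrict {G : Type*} [Group G] {P K : Subgroup G}
    (hPK : ∀ g : G, ∃ p ∈ P, ∃ k ∈ K, g = p * k) {R : Type*} [CommRing R]
    {f : G → R} (hf : IsHeckeFunction K f) :
    IsHeckeFunction (K.subgroupOf P) (fun p : ↥P => f ↑p) := by
  classical
  refine ⟨fun h hh h' hh' p => hf.1 h hh h' hh' p, ?_⟩
  obtain ⟨S, hS⟩ := hf.2
  choose p hp k hk hpk using hPK
  refine ⟨S.image fun y => ⟨p y, hp y⟩, fun q hq => ?_⟩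
  obtain ⟨y, hy, hyq⟩ : ∃ y ∈ S, y⁻¹ * q ∈ K := by
    simpa using hS (show (q : G) ∈ Function.support f from hq)
  simp only [Set.mem_iUnion]
  refine ⟨⟨p y, hp y⟩, Finset.mem_image_of_mem _ hy, ⟨p y, hp y⟩⁻¹ * q, ?_, by simp⟩
  have : (p y)⁻¹ * (q : G) = k y * (y⁻¹ * q) := by
    rw [inv_mul_eq_iff_eq_mul, ← mul_assoc, ← hpk, mul_inv_cancel_left]
  simpa [Subgroup.mem_subgroupOf, this] using K.mul_mem (hk y) hyq

/-- If `G = PK`, the inclusion of `P` induces a bijection `P / (P ∩ K) → G / K`. -/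
theorem bijective_quotient_subgroupOf {G : Type*} [Group G] {P K : Subgroup G}
    (hPK : ∀ g : G, ∃ p ∈ P, ∃ k ∈ K, g = p * k) :
    Function.Bijective
      (fun c : ↥P ⧸ K.subgroupOf P => ((Quotient.out c : ↥P) : G ⧸ K)) := by
  constructor
  · intro c d hcd
    have h : ((Quotient.out c : ↥P) : G)⁻¹ * (Quotient.out d : ↥P) ∈ K :=
      QuotientGroup.eq.mp hcd
    rw [← QuotientGroup.out_eq' c, ← QuotientGroup.out_eq' d]
    exact QuotientGroup.eq.mpr h
  · intro c
    induction c using QuotientGroup.induction_on with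
    | H g =>
      obtain ⟨p, hp, k, hk, rfl⟩ := hPK g
      refine ⟨((⟨p, hp⟩ : ↥P) : ↥P ⧸ K.subgroupOf P), ?_⟩
      have h : (Quotient.out ((⟨p, hp⟩ : ↥P) : ↥P ⧸ K.subgroupOf P))⁻¹ * ⟨p, hp⟩
          ∈ K.subgroupOf P := QuotientGroup.eq.mp (QuotientGroup.out_eq' _)
      refine QuotientGroup.eq.mpr ?_
      rw [← mul_assoc]
      exact K.mul_mem h hk

/-- If `G = PK` and `K_P = P ∩ K` (realized as `K.subgroupOf P`), then restriction to
`P` maps `H_R(G//K)` into `H_R(P//K_P)`, sends the unit `1_K` to the unit `1_{K_P}`,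
and is multiplicative for convolution: `(f ∗_K g)|_P = f|_P ∗_{K_P} g|_P`.  (It is
evidently `R`-linear, hence an `R`-algebra homomorphism.) -/
theorem hecke_restriction_algebra_hom
    {G : Type*} [Group G] (P K : Subgroup G)
    (hPK : ∀ g : G, ∃ p ∈ P, ∃ k ∈ K, g = p * k)
    {R : Type*} [CommRing R] :
    (∀ f : G → R, IsHeckeFunction K f →
      IsHeckeFunction (K.subgroupOf P) (fun p : ↥P => f ↑p)) ∧
    ((fun p : ↥P => Set.indicator (K : Set G) (fun _ => (1 : R)) ↑p)
      = Set.indicator ((K.subgroupOf P : Subgroup ↥P) : Set ↥P) (fun _ => (1 : R))) ∧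
    (∀ f g : G → R, IsHeckeFunction K f → IsHeckeFunction K g →
      (fun p : ↥P => heckeConv K f g ↑p)
        = heckeConv (K.subgroupOf P) (fun p : ↥P => f ↑p) (fun p : ↥P => g ↑p)) := by
  refine ⟨fun f hf => hf.restrict hPK, rfl, fun f g hf hg => funext fun x => ?_⟩
  refine (finsum_eq_of_bijective _ (bijective_quotient_subgroupOf hPK) fun c => ?_).symm
  exact hf.conv_term_eq hg (QuotientGroup.eq.mp (QuotientGroup.out_eq' _).symm) x
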